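/- arXiv:2204.09013 — 3 statements merged into one kernel-verified Lean document; each statement's English description precedes it below -/
import Mathlib

section
/- Let $w \in S_n$ be the spirograph permutation $w(i) = i + t \pmod{n}$ for a fixed $t$ with $1 \leq t \leq n-1$. Then $w$ has no alignments: there is no pair of indices $i \neq j$ whose arcs $(i \mapsto w(i))$ and $(j \mapsto w(j))$ are noncrossing and oriented in the same direction. -/
/-- Gale order on subsets of `Fin n`: compare the `h`-th smallest elements. -/
abbrev galeLE {n : ℕ} (I J : Finset (Fin n)) : Prop :=
  I.card = J.card ∧
    ∀ h < I.card, ((I.sort (· ≤ ·)).map Fin.val).getD h 0 ≤ ((J.sort (· ≤ ·)).map Fin.val).getD h 0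

/-- The initial set `y[k] = {y(1),...,y(k)}` of a permutation. -/
def initSet {n : ℕ} (y : Equiv.Perm (Fin n)) (k : ℕ) : Finset (Fin n) :=
  (Finset.univ.filter fun j : Fin n => j.val < k).image y

/-- Bruhat order via the tableau criterion. -/
def bruhatLE {n : ℕ} (u v : Equiv.Perm (Fin n)) : Prop :=
  ∀ k : ℕ, galeLE (initSet u k) (initSet v k)

/-- `v` is `k`-Grassmannian: increasing on the first `k` positions and on the rest. -/
def isGrassmannian {n : ℕ} (v : Equiv.Perm (Fin n)) (k : ℕ) : Prop :=
  (∀ i j : Fin n, i < j → j.val < k → v i < v j) ∧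
    (∀ i j : Fin n, i < j → k ≤ i.val → v i < v j)

/-- The points `a,b,c,d` occur (weakly) in this clockwise cyclic order. -/
abbrev cyclic4 (a b c d : ℕ) : Prop :=
  ((if b < a then 1 else 0) + (if c < b then 1 else 0) +
      (if d < c then 1 else 0) + (if a < d then 1 else 0) : ℕ) ≤ 1

/-- Arcs `i ↦ w i` and `j ↦ w j` form an alignment (in this order):
the points occur clockwise as `i, w i, w j, j`. -/
abbrev isAlignment {n : ℕ} (w : Equiv.Perm (Fin n)) (i j : Fin n) : Prop :=
  i ≠ j ∧ cyclic4 i.val (w i).val (w j).val j.val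

/-- Arcs `i ↦ w i` and `j ↦ w j` form a misalignment (in this order):
the points occur clockwise as `i, w i, j, w j`. -/
abbrev isMisalignment {n : ℕ} (w : Equiv.Perm (Fin n)) (i j : Fin n) : Prop :=
  i ≠ j ∧ cyclic4 i.val (w i).val j.val (w j).val

/-- `x` lies strictly inside the clockwise open arc from `a` to `b`. -/
abbrev cIoo (a b x : ℕ) : Prop :=
  (a < b ∧ a < x ∧ x < b) ∨ (b ≤ a ∧ (x < b ∨ a < x))

/-- Arcs `i ↦ w i` and `j ↦ w j` must cross: exactly one endpoint of the second
arc lies strictly inside the clockwise arc from `i` to `w i`. -/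
abbrev isCrossing {n : ℕ} (w : Equiv.Perm (Fin n)) (i j : Fin n) : Prop :=
  i ≠ j ∧ Xor' (cIoo i.val (w i).val j.val) (cIoo i.val (w i).val (w j).val)

/-- The shifted anti-exceedance set `I_r(w) = {i : i <_r w⁻¹ i}` (0-indexed start `r`). -/
abbrev antiExc {n : ℕ} (w : Equiv.Perm (Fin n)) (r : Fin n) : Finset (Fin n) :=
  Finset.univ.filter fun i => (i - r).val < (w.symm i - r).val

/-- The shifted Gale order `⪯_r`, obtained by rotating so that `r` is smallest. -/
abbrev shiftedGaleLE {n : ℕ} (r : Fin n) (I J : Finset (Fin n)) : Prop :=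
  galeLE (I.image fun x => x - r) (J.image fun x => x - r)

/-- The collection `{y[k] : y ∈ [u,v]}`. -/
def intervalBases {n : ℕ} (u v : Equiv.Perm (Fin n)) (k : ℕ) : Set (Finset (Fin n)) :=
  {I | ∃ y : Equiv.Perm (Fin n), bruhatLE u y ∧ bruhatLE y v ∧ initSet y k = I}

/-- The spirograph permutation `w(i) = i + t (mod n)` has no alignments. -/
theorem spirograph_no_alignments (n : ℕ) [NeZero n] (t : Fin n) (ht : t ≠ 0) :
    ∀ i j : Fin n, ¬ isAlignment (Equiv.addRight t) i j := by
  rintro i j ⟨hij, h⟩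
  have hne : i.val ≠ j.val := fun e => hij (Fin.ext e)
  have ht' : t.val ≠ 0 := fun e => ht (Fin.ext e)
  simp only [cyclic4, Equiv.coe_addRight, Fin.val_add_eq_ite] at h
  have := i.isLt
  have := j.isLt
  have := t.isLt
  split_ifs at h <;> omega
end

section
/- The set of bases $\{y[k] : y \in [u,v]\}$, where $v$ is $k$-Grassmannian and $u \leq v$, satisfies the Basis Exchange Property and hence forms the bases of a matroid of rank $k$ on $[n]$. -/
open Finset

/-- The number of indices `x ∈ A` whose arc `[lo x, hi x]` lies in the half-open interval
`[p, q)`. -/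
def arcCount {n : ℕ} (A : Finset (Fin n)) (lo hi : Fin n → Fin n) (p q : ℕ) : ℕ :=
  #{x ∈ A | p ≤ (lo x).val ∧ (hi x).val < q}

/-- Every interval contains at least as many elements of `I` as arcs `[u x, v x]` with `x ∈ A`,
and at least as many elements of `Iᶜ` as arcs `[v x, u x]` with `x ∉ A`. -/
def FitsArcs {n : ℕ} (A : Finset (Fin n)) (u v : Fin n → Fin n) (I : Finset (Fin n)) : Prop :=
  ∀ p q : ℕ, arcCount A u v p q ≤ arcCount I id id p q ∧
    arcCount Aᶜ v u p q ≤ arcCount Iᶜ id id p q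

section ArcCount

variable {n : ℕ} (A : Finset (Fin n)) (lo hi : Fin n → Fin n)

theorem arcCount_supermodular {p p' q q' : ℕ} (hp : p ≤ p') (hq : q ≤ q') :
    arcCount A lo hi p q + arcCount A lo hi p' q' ≤
      arcCount A lo hi p q' + arcCount A lo hi p' q := by
  simp only [arcCount, card_filter, ← sum_add_distrib]
  refine sum_le_sum fun x _ => ?_
  split_ifs <;> omega

theorem arcCount_add {p q r : ℕ} (hpq : p ≤ q) (hqr : q ≤ r) :
    arcCount A lo lo p q + arcCount A lo lo q r = arcCount A lo lo p r := by
  simp only [arcCount, card_filter, ← sum_add_distrib]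
  refine sum_congr rfl fun x _ => ?_
  split_ifs <;> omega

theorem arcCount_le_add_hi (p q r : ℕ) :
    arcCount A lo hi p r ≤ arcCount A lo hi p q + arcCount A hi hi q r := by
  simp only [arcCount, card_filter, ← sum_add_distrib]
  refine sum_le_sum fun x _ => ?_
  split_ifs <;> omega

theorem arcCount_le_add_lo (p q r : ℕ) :
    arcCount A lo hi p r ≤ arcCount A lo hi q r + arcCount A lo lo p q := by
  simp only [arcCount, card_filter, ← sum_add_distrib]
  refine sum_le_sum fun x _ => ?_
  split_ifs <;> omega

theorem arcCount_add_compl (p q : ℕ) :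
    arcCount A lo hi p q + arcCount Aᶜ lo hi p q = arcCount univ lo hi p q := by
  simp only [arcCount, card_filter]
  exact sum_add_sum_compl A _

theorem arcCount_univ_perm (w : Equiv.Perm (Fin n)) (p q : ℕ) :
    arcCount univ w w p q = arcCount (univ : Finset (Fin n)) id id p q := by
  simp only [arcCount, card_filter, id]
  exact Equiv.sum_comp w fun x : Fin n => if p ≤ x.val ∧ x.val < q then 1 else 0

theorem arcCount_full : arcCount A lo hi 0 n = #A := by
  simp [arcCount]

theorem arcCount_image (w : Equiv.Perm (Fin n)) (p q : ℕ) :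
    arcCount (A.image w) id id p q = arcCount A w w p q := by
  simp only [arcCount, filter_image, id]
  exact card_image_of_injective _ w.injective

theorem arcCount_erase {a : Fin n} (ha : a ∈ A) (p q : ℕ) :
    arcCount A lo hi p q = (if p ≤ (lo a).val ∧ (hi a).val < q then 1 else 0) +
      arcCount (A.erase a) lo hi p q := by
  simp only [arcCount, card_filter]
  exact (add_sum_erase A (fun x => if p ≤ (lo x).val ∧ (hi x).val < q then 1 else 0) ha).symm

theorem arcCount_exchange {I : Finset (Fin n)} {a b : Fin n} (ha : a ∈ I) (hb : b ∉ I) (p q : ℕ) :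
    arcCount (insert b (I.erase a)) id id p q + (if p ≤ a.val ∧ a.val < q then 1 else 0) =
      arcCount I id id p q + (if p ≤ b.val ∧ b.val < q then 1 else 0) := by
  have hb' : b ∉ I.erase a := fun h => hb (mem_of_mem_erase h)
  rw [arcCount_erase _ _ _ (mem_insert_self b _), arcCount_erase I _ _ ha, erase_insert hb']
  simp only [id]
  ring

end ArcCount

theorem FitsArcs.card_eq {n : ℕ} {A I : Finset (Fin n)} {u v : Fin n → Fin n}
    (h : FitsArcs A u v I) : #I = #A := by
  have h1 := h 0 n
  simp only [arcCount_full, card_compl] at h1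
  have := card_le_univ A
  have := card_le_univ I
  omega

/-- A lower-tight interval `[p, q)` and an upper-tight interval `[p', q')` overlapping it from the
right uncross: `[p, p')` is lower-tight. -/
theorem FitsArcs.tight_left {n : ℕ} {A I : Finset (Fin n)} {u v : Equiv.Perm (Fin n)}
    (h : FitsArcs A u v I) {p q p' q' : ℕ} (hp : p ≤ p') (hpq : p' ≤ q) (hq : q ≤ q')
    (hT : arcCount I id id p q = arcCount A u v p q)
    (hH : arcCount Iᶜ id id p' q' = arcCount Aᶜ v u p' q') :
    arcCount I id id p p' = arcCount A u v p p' := by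
  have h1 := arcCount_le_add_hi A u v p p' q
  have h2 := arcCount_le_add_lo Aᶜ v u p' q q'
  have h3 := arcCount_add_compl A v v p' q
  have h4 := arcCount_univ_perm v p' q
  have h5 := arcCount_add_compl I id id p' q
  have h6 := arcCount_add I id hp hpq
  have h7 := arcCount_add Iᶜ id hpq hq
  have h8 := (h p p').1
  have h9 := (h q q').2
  omega

/-- A lower-tight interval `[p, q)` and an upper-tight interval `[p', q')` overlapping it from the
left uncross: `[q', q)` is lower-tight. -/
theorem FitsArcs.tight_right {n : ℕ} {A I : Finset (Fin n)} {u v : Equiv.Perm (Fin n)}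
    (h : FitsArcs A u v I) {p q p' q' : ℕ} (hp : p' ≤ p) (hpq : p ≤ q') (hq : q' ≤ q)
    (hT : arcCount I id id p q = arcCount A u v p q)
    (hH : arcCount Iᶜ id id p' q' = arcCount Aᶜ v u p' q') :
    arcCount I id id q' q = arcCount A u v q' q := by
  have h1 := arcCount_le_add_lo A u v p q' q
  have h2 := arcCount_le_add_hi Aᶜ v u p' p q'
  have h3 := arcCount_add_compl A u u p q'
  have h4 := arcCount_univ_perm u p q'
  have h5 := arcCount_add_compl I id id p q'
  have h6 := arcCount_add I id hpq hq
  have h7 := arcCount_add Iᶜ id hp hpq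
  have h8 := (h q' q).1
  have h9 := (h p' p).2
  omega

/-- Tight intervals that overlap or touch have tight union and intersection. -/
theorem tight_uncross {n : ℕ} {A I : Finset (Fin n)} {lo hi : Fin n → Fin n}
    (h : ∀ p q, arcCount A lo hi p q ≤ arcCount I id id p q) {p q p' q' : ℕ}
    (h1 : p ≤ q') (h2 : p' ≤ q)
    (hT : arcCount I id id p q = arcCount A lo hi p q)
    (hT' : arcCount I id id p' q' = arcCount A lo hi p' q') :
    arcCount I id id (min p p') (max q q') = arcCount A lo hi (min p p') (max q q') ∧
      arcCount I id id (max p p') (min q q') = arcCount A lo hi (max p p') (min q q') := by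
  have key : ∀ {p q p' q' : ℕ}, p ≤ p' → p' ≤ q → q ≤ q' →
      arcCount I id id p q = arcCount A lo hi p q →
      arcCount I id id p' q' = arcCount A lo hi p' q' →
      arcCount I id id p q' = arcCount A lo hi p q' ∧
        arcCount I id id p' q = arcCount A lo hi p' q := by
    intro p q p' q' hp hm hq hT hT'
    have e1 := arcCount_add I id hp hm
    have e2 := arcCount_add I id hm hq
    have e3 := arcCount_add I id hp (hm.trans hq)
    have e4 := arcCount_supermodular A lo hi hp hq
    have e5 := h p q'
    have e6 := h p' q
    omega
  rcases le_total p p' with hp | hp <;> rcases le_total q q' with hq | hq <;>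
    simp only [min_eq_left, min_eq_right, max_eq_left, max_eq_right, hp, hq]
  · exact key hp h2 hq hT hT'
  · exact ⟨hT, hT'⟩
  · exact ⟨hT', hT⟩
  · exact key hp h1 hq hT' hT

theorem exists_minimal_pair {P : ℕ → ℕ → Prop} (f : ℕ → ℕ → ℕ) (h : ∃ p q, P p q) :
    ∃ p q, P p q ∧ ∀ p' q', P p' q' → f p q ≤ f p' q' := by
  obtain ⟨p₀, q₀, h₀⟩ := h
  obtain ⟨⟨p, q⟩, hm, hmin⟩ := (measure fun x : ℕ × ℕ => f x.1 x.2).wf.has_min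
    {x | P x.1 x.2} ⟨(p₀, q₀), h₀⟩
  exact ⟨p, q, hm, fun p' q' h' => not_lt.1 (hmin (p', q') h')⟩

/-- If each element of `(J \ I) ∩ T` lies in a part `X ⊆ T` of a disjoint family with
`#(J ∩ X) ≤ #(I ∩ X)` and all parts avoid some `a ∈ (I \ J) ∩ T`, then `#(J ∩ T) < #(I ∩ T)`. -/
theorem card_inter_lt_of_cover {α : Type*} [DecidableEq α] {I J T : Finset α} {a : α}
    (haI : a ∈ I) (haJ : a ∉ J) (haT : a ∈ T) (F : Finset (Finset α))
    (hdisj : ∀ X ∈ F, ∀ Y ∈ F, X ≠ Y → Disjoint X Y)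
    (hsub : ∀ X ∈ F, X ⊆ T) (ha : ∀ X ∈ F, a ∉ X) (hcard : ∀ X ∈ F, #(J ∩ X) ≤ #(I ∩ X))
    (hcov : ∀ b ∈ J, b ∉ I → b ∈ T → ∃ X ∈ F, b ∈ X) : #(J ∩ T) < #(I ∩ T) := by
  set Y := F.biUnion id with hY
  have hYT : Y ⊆ T := biUnion_subset.2 hsub
  have hsum : ∀ K : Finset α, #(K ∩ Y) = ∑ X ∈ F, #(K ∩ X) := fun K => by
    rw [hY, inter_biUnion, card_biUnion]
    · rfl
    · exact fun X hX Z hZ hne =>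
        (hdisj X hX Z hZ hne).mono inter_subset_right inter_subset_right
  have hin : #(J ∩ Y) ≤ #(I ∩ Y) := by
    rw [hsum, hsum]; exact sum_le_sum hcard
  have haY : a ∉ Y := by
    simpa [hY] using ha
  have hout : #(J ∩ (T \ Y)) < #(I ∩ (T \ Y)) := by
    refine card_lt_card (Finset.ssubset_iff_of_subset ?_ |>.2 ⟨a, ?_, ?_⟩)
    · intro b hb
      simp only [mem_inter, mem_sdiff] at hb ⊢
      refine ⟨?_, hb.2⟩
      by_contra hbI
      obtain ⟨X, hX, hbX⟩ := hcov b hb.1 hbI hb.2.1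
      exact hb.2.2 (mem_biUnion.2 ⟨X, hX, hbX⟩)
    · simp [haI, haT, haY]
    · simp [haJ]
  have hsplit : ∀ K : Finset α, #(K ∩ T) = #(K ∩ Y) + #(K ∩ (T \ Y)) := fun K => by
    rw [← card_union_of_disjoint, ← inter_union_distrib_left, union_sdiff_of_subset hYT]
    exact disjoint_sdiff.mono inter_subset_right inter_subset_right
  rw [hsplit, hsplit]
  omega

theorem FitsArcs.exchange {n : ℕ} {A I J : Finset (Fin n)} {u v : Equiv.Perm (Fin n)}
    (hI : FitsArcs A u v I) (hJ : FitsArcs A u v J) {a : Fin n} (haI : a ∈ I) (haJ : a ∉ J) :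
    ∃ b ∈ J, b ∉ I ∧ FitsArcs A u v (insert b (I.erase a)) := by
  by_contra! hno
  obtain ⟨p, q, ⟨hpa, haq, hT⟩, hmin⟩ := exists_minimal_pair
    (P := fun p q => p ≤ a.val ∧ a.val < q ∧ arcCount I id id p q = arcCount A u v p q)
    (fun p q => q - p)
    ⟨0, n, by omega, a.isLt, by rw [arcCount_full, arcCount_full, hI.card_eq]⟩
  -- upper-tight intervals which avoid `a` but meet the minimal lower-tight one lie inside it
  have hinside : ∀ b : Fin n, p ≤ b.val → b.val < q → ∀ p' q' : ℕ, p' ≤ b.val → b.val < q' →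
      ¬ (p' ≤ a.val ∧ a.val < q') → arcCount Iᶜ id id p' q' = arcCount Aᶜ v u p' q' →
      p ≤ p' ∧ q' ≤ q := by
    intro b hpb hbq p' q' hp'b hbq' hna hH
    by_contra hcon
    rcases lt_or_ge a.val p' with hap | hap
    · have := hmin p p' ⟨hpa, hap, hI.tight_left (by omega) (by omega) (by omega) hT hH⟩
      omega
    · have := hmin q' q ⟨by omega, haq, hI.tight_right (by omega) (by omega) (by omega) hT hH⟩
      omega
  have hblock : ∀ b ∈ J, b ∉ I → p ≤ b.val → b.val < q → ∃ p' q' : ℕ,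
      p' ≤ b.val ∧ b.val < q' ∧ ¬ (p' ≤ a.val ∧ a.val < q') ∧
      arcCount Iᶜ id id p' q' = arcCount Aᶜ v u p' q' := by
    intro b hbJ hbI hpb hbq
    by_contra! hfree
    refine hno b hbJ hbI fun p' q' => ?_
    have e1 := arcCount_exchange haI hbI p' q'
    have e2 := arcCount_add_compl I id id p' q'
    have e3 := arcCount_add_compl (insert b (I.erase a)) id id p' q'
    have e4 := hI p' q'
    by_cases ha : p' ≤ a.val ∧ a.val < q' <;> by_cases hb : p' ≤ b.val ∧ b.val < q'
    · simp only [ha, hb, and_self, if_true] at e1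
      omega
    · simp only [ha, hb, and_self, if_true, if_false] at e1
      have : arcCount I id id p' q' ≠ arcCount A u v p' q' := fun hT' => by
        have h1 := (tight_uncross (fun p q => (hI p q).1) (by omega) (by omega) hT hT').2
        have h2 := hmin _ _ ⟨by omega, by omega, h1⟩
        omega
      omega
    · simp only [ha, hb, and_self, if_true, if_false] at e1
      have := hfree p' q' hb.1 hb.2 (fun h1 => by omega)
      omega
    · simp only [ha, hb, if_false] at e1
      omega
  have hmax : ∀ b : Fin n, ∃ p' q' : ℕ, b ∈ J → b ∉ I → p ≤ b.val → b.val < q →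
      (p' ≤ b.val ∧ b.val < q' ∧ ¬ (p' ≤ a.val ∧ a.val < q') ∧
        arcCount Iᶜ id id p' q' = arcCount Aᶜ v u p' q') ∧
      ∀ p'' q'' : ℕ, (p'' ≤ b.val ∧ b.val < q'' ∧ ¬ (p'' ≤ a.val ∧ a.val < q'') ∧
        arcCount Iᶜ id id p'' q'' = arcCount Aᶜ v u p'' q'') → q'' - p'' ≤ q' - p' := by
    intro b
    by_cases hb : b ∈ J ∧ b ∉ I ∧ p ≤ b.val ∧ b.val < q
    · obtain ⟨p', q', h', hm⟩ := exists_minimal_pair (fun p' q' => q - (q' - p'))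
        (hblock b hb.1 hb.2.1 hb.2.2.1 hb.2.2.2)
      refine ⟨p', q', fun _ _ _ _ => ⟨h', fun p'' q'' h'' => ?_⟩⟩
      have h1 := hm p'' q'' h''
      have h2 := hinside b hb.2.2.1 hb.2.2.2 p'' q'' h''.1 h''.2.1 h''.2.2.1 h''.2.2.2
      omega
    · exact ⟨0, 0, fun h1 h2 h3 h4 => absurd ⟨h1, h2, h3, h4⟩ hb⟩
  choose P Q hPQ using hmax
  have hmem : ∀ r s (x : Fin n), x ∈ (univ.filter fun x : Fin n => r ≤ x.val ∧ x.val < s) ↔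
      r ≤ x.val ∧ x.val < s := by simp
  have hcount : ∀ (K : Finset (Fin n)) r s,
      #(K ∩ univ.filter fun x : Fin n => r ≤ x.val ∧ x.val < s) = arcCount K id id r s := by
    intro K r s
    simp [arcCount, inter_filter]
  set D := univ.filter fun b : Fin n => b ∈ J ∧ b ∉ I ∧ p ≤ b.val ∧ b.val < q with hD
  have hPQ' : ∀ b ∈ D, _ := fun b hb => by
    simp only [hD, mem_filter, mem_univ, true_and] at hb
    exact And.intro hb (hPQ b hb.1 hb.2.1 hb.2.2.1 hb.2.2.2)
  have hlt := card_inter_lt_of_cover (T := univ.filter fun x : Fin n => p ≤ x.val ∧ x.val < q)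
    haI haJ (by simp; omega)
    (D.image fun b => univ.filter fun x : Fin n => P b ≤ x.val ∧ x.val < Q b) ?_ ?_ ?_ ?_ ?_
  · rw [hcount, hcount] at hlt
    have := (hJ p q).1
    omega
  · simp only [forall_mem_image]
    intro b hb c hc hne
    obtain ⟨-, ⟨hb1, hb2, hb3, hb4⟩, hb5⟩ := hPQ' b hb
    obtain ⟨-, ⟨hc1, hc2, hc3, hc4⟩, hc5⟩ := hPQ' c hc
    rw [disjoint_left]
    intro x hx hx'
    rw [hmem] at hx hx'
    have hun := (tight_uncross (fun p q => (hI p q).2) (by omega) (by omega) hb4 hc4).1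
    have h1 := hb5 _ _ ⟨by omega, by omega, by omega, hun⟩
    have h2 := hc5 _ _ ⟨by omega, by omega, by omega, hun⟩
    have h3 : P b = P c := by omega
    have h4 : Q b = Q c := by omega
    exact hne (by rw [h3, h4])
  · simp only [forall_mem_image]
    intro b hb x hx
    obtain ⟨hbD, ⟨hb1, hb2, hb3, hb4⟩, -⟩ := hPQ' b hb
    have := hinside b hbD.2.2.1 hbD.2.2.2 _ _ hb1 hb2 hb3 hb4
    rw [hmem] at hx ⊢
    omega
  · simp only [forall_mem_image]
    intro b hb
    rw [hmem]
    exact (hPQ' b hb).2.1.2.2.1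
  · simp only [forall_mem_image]
    intro b hb
    rw [hcount, hcount]
    have h1 := (hPQ' b hb).2.1.2.2.2
    have h2 := (hJ (P b) (Q b)).2
    have h3 := arcCount_add_compl I id id (P b) (Q b)
    have h4 := arcCount_add_compl J id id (P b) (Q b)
    omega
  · intro b hbJ hbI hbT
    rw [hmem] at hbT
    have hbD : b ∈ D := by simp [hD, hbJ, hbI, hbT]
    refine ⟨_, mem_image_of_mem _ hbD, ?_⟩
    rw [hmem]
    exact ⟨(hPQ' b hbD).2.1.1, (hPQ' b hbD).2.1.2.1⟩

/-- Hall's theorem for intervals. -/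
theorem exists_injOn_of_arcCount_le {n : ℕ} (lo hi : Fin n → Fin n) (A : Finset (Fin n)) :
    ∀ I : Finset (Fin n), (∀ p q, arcCount A lo hi p q ≤ arcCount I id id p q) →
      ∃ g : Fin n → Fin n, Set.InjOn g A ∧ ∀ x ∈ A, g x ∈ I ∧ lo x ≤ g x ∧ g x ≤ hi x := by
  induction A using Finset.strongInduction with
  | H A ih =>
  intro I h
  rcases A.eq_empty_or_nonempty with rfl | hA
  · exact ⟨id, by simp, by simp⟩
  obtain ⟨j, hjA, hj⟩ := exists_min_image A hi hA
  have hpos : 0 < arcCount I id id (lo j) (hi j + 1) := lt_of_lt_of_le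
    (card_pos.2 ⟨j, by simp [hjA]⟩) (h (lo j) (hi j + 1))
  obtain ⟨x₀, hx₀⟩ := card_pos.1 hpos
  simp only [id, mem_filter] at hx₀
  obtain ⟨x, hx, hxmin⟩ := exists_min_image (I.filter fun x => lo j ≤ x) id
    ⟨x₀, mem_filter.2 ⟨hx₀.1, hx₀.2.1⟩⟩
  simp only [mem_filter, id, Fin.le_def] at hx hxmin
  have hxx₀ := hxmin x₀ ⟨hx₀.1, hx₀.2.1⟩
  have hjle : ∀ a ∈ A, (hi j).val ≤ (hi a).val := hj
  obtain ⟨g, hg, hgI⟩ := ih (A.erase j) (erase_ssubset hjA) (I.erase x) fun p q => by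
    have e1 := arcCount_erase A lo hi hjA p q
    have e3 := h p q
    have e4 := arcCount_erase I id id hx.1 p q
    simp only [id] at e4
    by_cases hxpq : p ≤ x.val ∧ x.val < q
    · by_cases hq : (hi j).val < q
      · by_cases hp : p ≤ (lo j).val
        · simp only [hp, hq, hxpq, and_self, if_true] at e1 e4
          omega
        · have e5 : arcCount (I.erase x) id id (lo j) q ≤ arcCount (I.erase x) id id p q := by
            refine card_le_card fun y hy => ?_
            simp only [id, mem_filter, mem_erase] at hy ⊢
            have h1 := hxmin y ⟨hy.1.2, hy.2.1⟩
            refine ⟨hy.1, ?_, hy.2.2⟩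
            omega
          have e6 : arcCount (A.erase j) lo hi p q + 1 ≤ arcCount A lo hi (lo j) q := by
            have e9 := arcCount_erase A lo hi hjA (lo j) q
            simp only [hq, le_refl, and_self, if_true] at e9
            have : arcCount (A.erase j) lo hi p q ≤ arcCount (A.erase j) lo hi (lo j) q := by
              refine card_le_card fun y hy => ?_
              simp only [mem_filter] at hy ⊢
              exact ⟨hy.1, by omega, hy.2.2⟩
            omega
          have e7 := h (lo j) q
          have e8 := arcCount_erase I id id hx.1 (lo j) q
          simp only [id] at e8
          have : (lo j).val ≤ x.val ∧ x.val < q := ⟨hx.2, hxpq.2⟩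
          simp only [this, and_self, if_true] at e8
          omega
      · have : arcCount (A.erase j) lo hi p q = 0 := by
          refine card_eq_zero.2 (filter_eq_empty_iff.2 fun y hy => ?_)
          have := hjle y (mem_of_mem_erase hy)
          omega
        omega
    · simp only [hxpq, if_false] at e4
      omega
  refine ⟨Function.update g j x, ?_, ?_⟩
  · intro a ha b hb hab
    have hne : ∀ c ∈ A, c ≠ j → g c ≠ x := fun c hc hcj hgx =>
      (mem_erase.1 (hgI c (mem_erase.2 ⟨hcj, hc⟩)).1).1 hgx
    by_cases haj : a = j <;> by_cases hbj : b = j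
    · rw [haj, hbj]
    · subst haj
      simp only [Function.update_self, Function.update_of_ne hbj] at hab
      exact absurd hab.symm (hne b hb hbj)
    · subst hbj
      simp only [Function.update_self, Function.update_of_ne haj] at hab
      exact absurd hab (hne a ha haj)
    · simp only [Function.update_of_ne haj, Function.update_of_ne hbj] at hab
      exact hg (by simpa [haj] using ha) (by simpa [hbj] using hb) hab
  · intro a ha
    by_cases haj : a = j
    · subst haj
      simp only [Function.update_self, Fin.le_def]
      exact ⟨hx.1, hx.2, by omega⟩
    · simp only [Function.update_of_ne haj]
      have := hgI a (mem_erase.2 ⟨haj, ha⟩)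
      exact ⟨mem_of_mem_erase this.1, this.2⟩

section Gale

variable {n : ℕ}

theorem card_filter_le_eq_orderEmbOfFin {m : ℕ} (I : Finset (Fin n)) (hI : #I = m) (q : ℕ) :
    #{x ∈ I | q ≤ x.val} = #{i : Fin m | q ≤ (I.orderEmbOfFin hI i).val} := by
  conv_lhs => rw [← image_orderEmbOfFin_univ I hI]
  rw [filter_image, card_image_of_injective _ (I.orderEmbOfFin hI).injective]

theorem sort_getD_eq_orderEmbOfFin {m : ℕ} (I : Finset (Fin n)) (hI : #I = m) (i : Fin m) :
    ((I.sort (· ≤ ·)).map Fin.val).getD i 0 = (I.orderEmbOfFin hI i).val := by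
  have : i.val < (I.sort (· ≤ ·)).length := by simp [hI]
  rw [List.getD_eq_getElem _ _ (by simpa using this), List.getElem_map, orderEmbOfFin_apply]
  rfl

theorem galeLE_iff_card_filter_le {I J : Finset (Fin n)} :
    galeLE I J ↔ #I = #J ∧ ∀ q : ℕ, #{x ∈ I | q ≤ x.val} ≤ #{x ∈ J | q ≤ x.val} := by
  refine and_congr_right fun hIJ => ?_
  have hJ : #J = #I := hIJ.symm
  constructor
  · intro h q
    rw [card_filter_le_eq_orderEmbOfFin I rfl, card_filter_le_eq_orderEmbOfFin J hJ]
    refine card_le_card fun i hi => ?_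
    have hi' := h i i.isLt
    rw [sort_getD_eq_orderEmbOfFin I rfl, sort_getD_eq_orderEmbOfFin J hJ] at hi'
    simp only [mem_filter, mem_univ, true_and] at hi ⊢
    exact hi.trans hi'
  · intro h i hi
    have e1 := sort_getD_eq_orderEmbOfFin I rfl ⟨i, hi⟩
    have e2 := sort_getD_eq_orderEmbOfFin J hJ ⟨i, hi⟩
    rw [e1, e2]
    by_contra! hlt
    have hc := h (I.orderEmbOfFin rfl ⟨i, hi⟩).val
    rw [card_filter_le_eq_orderEmbOfFin I rfl, card_filter_le_eq_orderEmbOfFin J hJ] at hc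
    refine hc.not_gt (card_lt_card ?_)
    refine (Finset.ssubset_iff_of_subset fun j hj => ?_).2 ⟨⟨i, hi⟩, ?_, ?_⟩
    · simp only [mem_filter, mem_univ, true_and, Fin.val_fin_le, OrderEmbedding.le_iff_le] at hj ⊢
      by_contra! hji
      have : J.orderEmbOfFin hJ j ≤ J.orderEmbOfFin hJ ⟨i, hi⟩ :=
        (J.orderEmbOfFin hJ).monotone hji.le
      simp only [Fin.le_def] at this hj
      omega
    · simp
    · simp only [mem_filter, mem_univ, true_and]
      omega

theorem card_filter_initSet (u : Equiv.Perm (Fin n)) (p q : ℕ) :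
    #{x ∈ initSet u p | q ≤ x.val} = #{x : Fin n | x.val < p ∧ q ≤ (u x).val} := by
  rw [initSet, filter_image, card_image_of_injective _ u.injective, filter_filter]

theorem bruhatLE_iff_head {u v : Equiv.Perm (Fin n)} :
    bruhatLE u v ↔ ∀ p q : ℕ, #{x : Fin n | x.val < p ∧ q ≤ (u x).val} ≤
      #{x : Fin n | x.val < p ∧ q ≤ (v x).val} := by
  refine forall_congr' fun p => ?_
  simp only [galeLE_iff_card_filter_le, card_filter_initSet]
  refine and_iff_right ?_
  simp only [initSet, card_image_of_injective _ (Equiv.injective _)]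

theorem card_head_add (u : Equiv.Perm (Fin n)) (p q : ℕ) :
    #{x : Fin n | x.val < p ∧ q ≤ (u x).val} + #{x : Fin n | p ≤ x.val} =
      #{x : Fin n | p ≤ x.val ∧ (u x).val < q} + #{x : Fin n | q ≤ x.val} := by
  have h : #{x : Fin n | q ≤ (u x).val} = #{x : Fin n | q ≤ x.val} := by
    simp only [card_filter]
    exact Equiv.sum_comp u fun x : Fin n => if q ≤ x.val then 1 else 0
  rw [← h]
  simp only [card_filter, ← sum_add_distrib]
  refine sum_congr rfl fun x _ => ?_
  split_ifs <;> omega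

theorem card_head_le_iff_card_tail_le (u v : Equiv.Perm (Fin n)) (p q : ℕ) :
    #{x : Fin n | x.val < p ∧ q ≤ (u x).val} ≤ #{x : Fin n | x.val < p ∧ q ≤ (v x).val} ↔
      #{x : Fin n | p ≤ x.val ∧ (u x).val < q} ≤ #{x : Fin n | p ≤ x.val ∧ (v x).val < q} := by
  have h1 := card_head_add u p q
  have h2 := card_head_add v p q
  omega

theorem bruhatLE_of_box {k : ℕ} {u v : Equiv.Perm (Fin n)} (h1 : ∀ x : Fin n, x.val < k → u x ≤ v x)
    (h2 : ∀ x : Fin n, k ≤ x.val → v x ≤ u x) : bruhatLE u v := by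
  refine bruhatLE_iff_head.2 fun p q => ?_
  simp only [Fin.le_def] at h1 h2
  rcases le_total p k with hp | hp
  · refine card_le_card fun x hx => ?_
    simp only [mem_filter, mem_univ, true_and] at hx ⊢
    have := h1 x (by omega)
    omega
  · refine (card_head_le_iff_card_tail_le u v p q).2 (card_le_card fun x hx => ?_)
    simp only [mem_filter, mem_univ, true_and] at hx ⊢
    have := h2 x (by omega)
    omega

end Gale

section Grassmannian

variable {n k : ℕ} {u v y : Equiv.Perm (Fin n)}

theorem isGrassmannian.apply_le_head (hv : isGrassmannian v k) (h : bruhatLE y v) {x : Fin n}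
    (hx : x.val < k) : y x ≤ v x := by
  have hc := bruhatLE_iff_head.1 h (x.val + 1) ((v x).val + 1)
  have h0 : #{z : Fin n | z.val < x.val + 1 ∧ (v x).val + 1 ≤ (v z).val} = 0 := by
    refine card_eq_zero.2 (filter_eq_empty_iff.2 fun z _ hz => ?_)
    rcases eq_or_ne z x with rfl | hne
    · omega
    · have := hv.1 z x (lt_of_le_of_ne (by simp only [Fin.le_def]; omega) hne) hx
      simp only [Fin.lt_def] at this
      omega
  rw [h0, Nat.le_zero, card_eq_zero, filter_eq_empty_iff] at hc
  have := hc (mem_univ x)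
  simp only [Fin.le_def]
  omega

theorem isGrassmannian.apply_le_tail (hv : isGrassmannian v k) (h : bruhatLE y v) {x : Fin n}
    (hx : k ≤ x.val) : v x ≤ y x := by
  have hc := (card_head_le_iff_card_tail_le y v x.val (v x).val).1
    (bruhatLE_iff_head.1 h x.val (v x).val)
  have h0 : #{z : Fin n | x.val ≤ z.val ∧ (v z).val < (v x).val} = 0 := by
    refine card_eq_zero.2 (filter_eq_empty_iff.2 fun z _ hz => ?_)
    rcases eq_or_ne x z with rfl | hne
    · omega
    · have := hv.2 x z (lt_of_le_of_ne hz.1 hne) hx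
      simp only [Fin.lt_def] at this
      omega
  rw [h0, Nat.le_zero, card_eq_zero, filter_eq_empty_iff] at hc
  have := hc (mem_univ x)
  simp only [Fin.le_def]
  omega

theorem initSet_compl (y : Equiv.Perm (Fin n)) (k : ℕ) :
    (initSet y k)ᶜ = (univ.filter fun j : Fin n => j.val < k)ᶜ.image y := by
  apply coe_injective
  rw [initSet, coe_compl, coe_image, coe_image, coe_compl, Set.image_compl_eq y.bijective]

/-- The members of the interval are exactly the sets which fit the arcs between `u` and `v`. -/
theorem mem_intervalBases_iff_fitsArcs (hv : isGrassmannian v k) (I : Finset (Fin n)) :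
    I ∈ intervalBases u v k ↔ FitsArcs (univ.filter fun j : Fin n => j.val < k) u v I := by
  constructor
  · rintro ⟨y, huy, hyv, rfl⟩ p q
    rw [initSet_compl, initSet, arcCount_image, arcCount_image]
    constructor
    · rcases (univ.filter fun x : Fin n => x.val < k ∧ (v x).val < q).eq_empty_or_nonempty with
        he | hne
      · refine le_trans (le_of_eq (card_eq_zero.2 (filter_eq_empty_iff.2 fun x hx hx' => ?_)))
          (Nat.zero_le _)
        simp only [mem_filter, mem_univ, true_and] at hx
        exact filter_eq_empty_iff.1 he (mem_univ x) ⟨hx, hx'.2⟩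
      obtain ⟨m, hm, hmax⟩ := exists_max_image _ id hne
      simp only [mem_filter, mem_univ, true_and, id, Fin.le_def] at hm hmax
      have hseg : ∀ x : Fin n, x.val < m.val + 1 → x.val < k ∧ (v x).val < q := fun x hx => by
        rcases eq_or_ne x m with rfl | hne
        · exact hm
        · have := hv.1 x m (lt_of_le_of_ne (by simp only [Fin.le_def]; omega) hne) hm.1
          simp only [Fin.lt_def] at this
          omega
      refine le_trans (card_le_card fun x hx => ?_)
        ((bruhatLE_iff_head.1 huy (m.val + 1) p).trans (card_le_card fun x hx => ?_))
      · simp only [mem_filter, mem_univ, true_and] at hx ⊢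
        have := hmax x ⟨hx.1, hx.2.2⟩
        omega
      · simp only [mem_filter, mem_univ, true_and] at hx ⊢
        have h1 := hseg x hx.1
        have h2 := hv.apply_le_head hyv h1.1
        simp only [Fin.le_def] at h2
        omega
    · rcases (univ.filter fun x : Fin n => k ≤ x.val ∧ p ≤ (v x).val).eq_empty_or_nonempty with
        he | hne
      · refine le_trans (le_of_eq (card_eq_zero.2 (filter_eq_empty_iff.2 fun x hx hx' => ?_)))
          (Nat.zero_le _)
        simp only [mem_compl, mem_filter, mem_univ, true_and, not_lt] at hx
        exact filter_eq_empty_iff.1 he (mem_univ x) ⟨hx, hx'.1⟩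
      obtain ⟨m, hm, hmin⟩ := exists_min_image _ id hne
      simp only [mem_filter, mem_univ, true_and, id, Fin.le_def] at hm hmin
      have hseg : ∀ x : Fin n, m.val ≤ x.val → k ≤ x.val ∧ p ≤ (v x).val := fun x hx => by
        rcases eq_or_ne m x with rfl | hne
        · exact hm
        · have := hv.2 m x (lt_of_le_of_ne hx hne) hm.1
          simp only [Fin.lt_def] at this
          omega
      refine le_trans (card_le_card fun x hx => ?_)
        (((card_head_le_iff_card_tail_le u y m.val q).1
          (bruhatLE_iff_head.1 huy m.val q)).trans (card_le_card fun x hx => ?_))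
      · simp only [mem_compl, mem_filter, mem_univ, true_and, not_lt] at hx ⊢
        have := hmin x ⟨hx.1, hx.2.1⟩
        omega
      · simp only [mem_compl, mem_filter, mem_univ, true_and, not_lt] at hx ⊢
        have h1 := hseg x hx.1
        have h2 := hv.apply_le_tail hyv h1.1
        simp only [Fin.le_def] at h2
        omega
  · intro h
    obtain ⟨g, hg, hgI⟩ := exists_injOn_of_arcCount_le u v _ I fun p q => (h p q).1
    obtain ⟨g', hg', hgI'⟩ := exists_injOn_of_arcCount_le v u _ Iᶜ fun p q => (h p q).2
    simp only [mem_compl, mem_filter, mem_univ, true_and, not_lt] at hgI hgI'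
    have hinj : Function.Injective fun x : Fin n => if x.val < k then g x else g' x := by
      intro x z hxz
      by_cases hx : x.val < k <;> by_cases hz : z.val < k <;>
        simp only [hx, hz, if_true, if_false] at hxz
      · exact hg (by simpa using hx) (by simpa using hz) hxz
      · exact absurd (hxz ▸ (hgI x hx).1) (hgI' z (by omega)).1
      · exact absurd (hxz ▸ (hgI z hz).1) (hgI' x (by omega)).1
      · exact hg' (by simpa using hx) (by simpa using hz) hxz
    set y := Equiv.ofBijective _ (Finite.injective_iff_bijective.1 hinj) with hy
    have hy1 : ∀ x : Fin n, x.val < k → y x = g x := fun x hx => by simp [hy, hx]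
    have hy2 : ∀ x : Fin n, k ≤ x.val → y x = g' x := fun x hx => by simp [hy, not_lt.2 hx]
    refine ⟨y, bruhatLE_of_box (k := k) (fun x hx => ?_) (fun x hx => ?_),
      bruhatLE_of_box (k := k) (fun x hx => ?_) (fun x hx => ?_), ?_⟩
    · rw [hy1 x hx]; exact (hgI x hx).2.1
    · rw [hy2 x hx]; exact (hgI' x hx).2.2
    · rw [hy1 x hx]; exact (hgI x hx).2.2
    · rw [hy2 x hx]; exact (hgI' x hx).2.1
    · refine eq_of_subset_of_card_le (fun z hz => ?_) ?_
      · simp only [initSet, mem_image, mem_filter, mem_univ, true_and] at hz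
        obtain ⟨x, hx, rfl⟩ := hz
        rw [hy1 x hx]
        exact (hgI x hx).1
      · rw [h.card_eq, initSet, card_image_of_injective _ y.injective]

end Grassmannian

/-- For `v` `k`-Grassmannian and `u ≤ v`, the collection `{y[k] : y ∈ [u,v]}` is
nonempty, consists of `k`-sets, and satisfies the Basis Exchange Property, hence forms
the bases of a matroid of rank `k` on `[n]`. -/
theorem intervalBases_matroid (n k : ℕ) (hk : k ≤ n) (u v : Equiv.Perm (Fin n))
    (hv : isGrassmannian v k) (huv : bruhatLE u v) :
    (intervalBases u v k).Nonempty ∧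
    (∀ I ∈ intervalBases u v k, I.card = k) ∧
    (∀ I ∈ intervalBases u v k, ∀ J ∈ intervalBases u v k, I ≠ J →
      ∀ a ∈ I, a ∉ J →
        ∃ b ∈ J, b ∉ I ∧ insert b (I.erase a) ∈ intervalBases u v k) := by
  refine ⟨⟨initSet u k, u, fun _ => ⟨rfl, fun _ _ => le_rfl⟩, huv, rfl⟩, ?_, ?_⟩
  · rintro _ ⟨y, -, -, rfl⟩
    rw [initSet, card_image_of_injective _ y.injective]
    simp [Fin.card_filter_val_lt, hk]
  · intro I hI J hJ _ a haI haJ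
    simp only [mem_intervalBases_iff_fitsArcs hv] at hI hJ ⊢
    exact hI.exchange hJ haI haJ
end

section
/- Let $w \in S_n$ be a derangement with anti-exceedance set $J = I_1(w)$. Define an anti-exchange pair to be a pair $(a, b)$ with $a \in J$, $b \notin J$, and $(J \setminus \{a\}) \cup \{b\} \notin \mathcal{M}(w)$. Then there is an injective map from the set of anti-exchange pairs of $J$ into the set of alignments of $w$; in particular, the number of anti-exchange pairs of $I_1(w)$ is at most the number of alignments of $w$. -/
theorem Fin.val_sub_eq_ite {n : ℕ} (x r : Fin n) :
    (x - r).val = if r ≤ x then x.val - r.val else x.val + n - r.val := by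
  split_ifs with h
  · exact Fin.sub_val_of_le h
  · have h' : x < r := not_le.mp h
    rw [Fin.coe_sub_iff_lt.mpr h']
    omega

theorem galeLE_of_card_filter_le {n : ℕ} {I K : Finset (Fin n)} (hcard : I.card = K.card)
    (h : ∀ t : ℕ, (K.filter fun x => x.val < t).card ≤ (I.filter fun x => x.val < t).card) :
    galeLE I K := by
  refine ⟨hcard, fun m hm => ?_⟩
  have hmK : m < K.card := hcard ▸ hm
  have getD_eq : ∀ (L : Finset (Fin n)) (hL : m < L.card),
      ((L.sort (· ≤ ·)).map Fin.val).getD m 0 = (L.orderEmbOfFin rfl ⟨m, hL⟩).val := by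
    intro L hL
    rw [List.getD_eq_getElem _ _ (by simpa using hL)]
    simp [Finset.orderEmbOfFin_apply]
  rw [getD_eq I hm, getD_eq K hmK]
  by_contra! hlt
  set eI := I.orderEmbOfFin rfl
  set eK := K.orderEmbOfFin rfl
  have hK : m + 1 ≤ (K.filter fun x => x.val < (eK ⟨m, hmK⟩).val + 1).card := by
    calc m + 1 = ((Finset.Iic (⟨m, hmK⟩ : Fin K.card)).map eK.toEmbedding).card := by simp
      _ ≤ _ := Finset.card_le_card fun x hx => by
        obtain ⟨i, hi, rfl⟩ := Finset.mem_map.mp hx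
        have := eK.monotone (Finset.mem_Iic.mp hi)
        exact Finset.mem_filter.mpr
          ⟨Finset.orderEmbOfFin_mem K rfl i, Nat.lt_succ_of_le (Fin.le_def.mp this)⟩
  have hI : (I.filter fun x => x.val < (eK ⟨m, hmK⟩).val + 1).card ≤ m := by
    calc _ ≤ ((Finset.Iio (⟨m, hm⟩ : Fin I.card)).map eI.toEmbedding).card :=
          Finset.card_le_card fun x hx => by
            obtain ⟨hxI, hx⟩ := Finset.mem_filter.mp hx
            obtain ⟨i, rfl⟩ : x ∈ Set.range eI := by
              rw [Finset.range_orderEmbOfFin]; exact hxI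
            refine Finset.mem_map.mpr ⟨i, Finset.mem_Iio.mpr ?_, rfl⟩
            rw [← eI.lt_iff_lt, Fin.lt_def]
            omega
      _ = m := by simp
  have := h ((eK ⟨m, hmK⟩).val + 1)
  omega

theorem shiftedGaleLE_of_card_filter_le {n : ℕ} [NeZero n] (r : Fin n) {I K : Finset (Fin n)}
    (hcard : I.card = K.card)
    (h : ∀ t : ℕ, (K.filter fun x => (x - r).val < t).card ≤
      (I.filter fun x => (x - r).val < t).card) :
    shiftedGaleLE r I K := by
  have inj : Function.Injective fun x : Fin n => x - r := sub_left_injective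
  refine galeLE_of_card_filter_le ?_ fun t => ?_
  · rw [Finset.card_image_of_injective _ inj, Finset.card_image_of_injective _ inj, hcard]
  · rw [Finset.filter_image, Finset.filter_image, Finset.card_image_of_injective _ inj,
      Finset.card_image_of_injective _ inj]
    exact h t

/-- As many arcs cross the gap before `r` leftwards as rightwards. -/
theorem Equiv.Perm.card_crossing_eq {n : ℕ} (v : Equiv.Perm (Fin n)) (r : Fin n) :
    (Finset.univ.filter fun x => x < r ∧ r ≤ v x).card =
      (Finset.univ.filter fun x => r ≤ x ∧ v x < r).card := by
  have key : (Finset.univ.filter fun x => v x < r).card =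
      (Finset.univ.filter fun x => x < r).card :=
    Finset.card_equiv v (by simp)
  have h1 := Finset.card_filter_add_card_filter_not
    (s := Finset.univ.filter fun x => x < r) (fun x => v x < r)
  have h2 := Finset.card_filter_add_card_filter_not
    (s := Finset.univ.filter fun x => v x < r) (fun x => x < r)
  simp only [Finset.filter_filter, not_lt] at h1 h2
  have h3 : (Finset.univ.filter fun x => x < r ∧ v x < r) =
      Finset.univ.filter fun x => v x < r ∧ x < r := by simp only [and_comm]
  have h4 : (Finset.univ.filter fun x => r ≤ x ∧ v x < r) =
      Finset.univ.filter fun x => v x < r ∧ r ≤ x := by simp only [and_comm]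
  rw [h3] at h1
  rw [h4]
  omega

theorem mem_antiExc_zero {n : ℕ} [NeZero n] (w : Equiv.Perm (Fin n)) (x : Fin n) :
    x ∈ antiExc w 0 ↔ x < w.symm x := by
  simp [antiExc]

theorem mem_antiExc {n : ℕ} (w : Equiv.Perm (Fin n)) (r x : Fin n) :
    x ∈ antiExc w r ↔ (x < w.symm x ∧ (x < r → w.symm x < r)) ∨ (r ≤ x ∧ w.symm x < r) := by
  have := x.isLt
  have := (w.symm x).isLt
  simp only [antiExc, Finset.mem_filter, Finset.mem_univ, true_and, Fin.val_sub_eq_ite,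
    Fin.lt_def, Fin.le_def]
  split_ifs <;> omega

theorem mem_antiExc_iff_of_le {n : ℕ} (w : Equiv.Perm (Fin n)) {r x : Fin n} (h : r ≤ x) :
    x ∈ antiExc w r ↔ x < w.symm x ∨ w.symm x < r := by
  rw [mem_antiExc]
  grind

theorem mem_antiExc_iff_of_lt {n : ℕ} (w : Equiv.Perm (Fin n)) {r x : Fin n} (h : x < r) :
    x ∈ antiExc w r ↔ x < w.symm x ∧ w.symm x < r := by
  rw [mem_antiExc]
  grind

theorem card_antiExc {n : ℕ} [NeZero n] (w : Equiv.Perm (Fin n)) (r : Fin n) :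
    (antiExc w r).card = (antiExc w 0).card := by
  have hr : antiExc w r = (Finset.univ.filter fun x =>
      x < w.symm x ∧ (x < r → w.symm x < r)) ∪
      (Finset.univ.filter fun x => r ≤ x ∧ w.symm x < r) := by
    ext x
    rw [mem_antiExc]
    simp
  have h0 : antiExc w 0 = (Finset.univ.filter fun x =>
      x < w.symm x ∧ (x < r → w.symm x < r)) ∪
      (Finset.univ.filter fun x => x < r ∧ r ≤ w.symm x) := by
    ext x
    rw [mem_antiExc_zero]
    simp only [Finset.mem_union, Finset.mem_filter, Finset.mem_univ, true_and]
    grind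
  rw [hr, h0, Finset.card_union_of_disjoint, Finset.card_union_of_disjoint,
    Equiv.Perm.card_crossing_eq]
  all_goals
    rw [Finset.disjoint_filter]
    grind

/-- Replacing `a` by `b` changes the size of a trace by at most one, and increases it only if
the trace contains `b` but not `a`. -/
theorem card_filter_exchange {α : Type*} [DecidableEq α] {J : Finset α} {a b : α} (ha : a ∈ J)
    (hb : b ∉ J) (P : α → Prop) [DecidablePred P] :
    ((insert b (J.erase a)).filter P).card + (if P a then 1 else 0) =
      (J.filter P).card + (if P b then 1 else 0) := by
  have hb' : b ∉ (J.erase a).filter P := fun h =>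
    hb (Finset.mem_of_mem_erase (Finset.mem_filter.mp h).1)
  have h1 : ((J.erase a).filter P).card + (if P a then 1 else 0) = (J.filter P).card := by
    rw [Finset.filter_erase]
    split_ifs with h
    · exact Finset.card_erase_add_one (Finset.mem_filter.mpr ⟨ha, h⟩)
    · rw [Finset.erase_eq_of_notMem (by simp [h]), add_zero]
  rw [Finset.filter_insert]
  split_ifs at h1 ⊢ <;> simp_all [Finset.card_insert_of_notMem]

/-- Some gap between `a` and `b`, before `r` say, is crossed by no rightward arc `v x → x` ending
in `[r, b]`. -/
abbrev GapRight {n : ℕ} (v : Equiv.Perm (Fin n)) (a b : Fin n) : Prop :=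
  ∃ r, a < r ∧ r ≤ b ∧ ∀ x, r ≤ x → x ≤ b → r ≤ v x

/-- Some gap between `a` and `b`, before `r` say, is crossed by no leftward arc `v x → x` ending
in `[a, r)`. -/
abbrev GapLeft {n : ℕ} (v : Equiv.Perm (Fin n)) (a b : Fin n) : Prop :=
  ∃ r, a < r ∧ r ≤ b ∧ ∀ x, a ≤ x → x < r → v x < r

/-- The arc ending at `p.1` is leftward, the one ending at `p.2` is rightward, and `p.1 < p.2`
only if there is a gap between them. -/
abbrev IsGapPair {n : ℕ} (v : Equiv.Perm (Fin n)) (p : Fin n × Fin n) : Prop :=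
  p.1 < v p.1 ∧ v p.2 < p.2 ∧ (p.1 < p.2 → GapRight v p.1 p.2 ∨ GapLeft v p.1 p.2)

/-- A failing exchange `a < b` is witnessed by a gap between `a` and `b`. -/
theorem exists_gap_of_anti_exchange {n : ℕ} [NeZero n] (w : Equiv.Perm (Fin n)) {a b : Fin n}
    (ha : a ∈ antiExc w 0) (hb : b ∉ antiExc w 0) (hab : a < b)
    (h : ¬ ∀ r : Fin n, shiftedGaleLE r (antiExc w r) (insert b ((antiExc w 0).erase a))) :
    GapRight w.symm a b ∨ GapLeft w.symm a b := by
  contrapose! h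
  obtain ⟨hright, hleft⟩ := h
  intro r
  have hcard : (antiExc w r).card = (insert b ((antiExc w 0).erase a)).card := by
    rw [card_antiExc, Finset.card_insert_of_notMem fun h => hb (Finset.mem_of_mem_erase h),
      Finset.card_erase_add_one ha]
  refine shiftedGaleLE_of_card_filter_le r hcard fun t => ?_
  have hex := card_filter_exchange ha hb
  by_cases ht : r.val + t ≤ n
  · have hP : ∀ x : Fin n, (x - r).val < t ↔ r ≤ x ∧ x.val < r.val + t := by
      intro x
      have := x.isLt
      rw [Fin.val_sub_eq_ite]
      split_ifs with hx <;> rw [Fin.le_def] at * <;> omega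
    simp only [hP]
    have hsub : (antiExc w 0).filter (fun x => r ≤ x ∧ x.val < r.val + t) ⊆
        (antiExc w r).filter fun x => r ≤ x ∧ x.val < r.val + t := by
      intro x hx
      obtain ⟨hxJ, hxP⟩ := Finset.mem_filter.mp hx
      exact Finset.mem_filter.mpr
        ⟨(mem_antiExc_iff_of_le w hxP.1).mpr (Or.inl ((mem_antiExc_zero w x).mp hxJ)), hxP⟩
    have hle := Finset.card_le_card hsub
    have := hex fun x => r ≤ x ∧ x.val < r.val + t
    by_cases hbt : r ≤ b ∧ b.val < r.val + t
    · by_cases har : a < r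
      · obtain ⟨x, hrx, hxb, hx⟩ := hright r har hbt.1
        have hlt := Finset.card_lt_card ((Finset.ssubset_iff_of_subset hsub).mpr ⟨x,
          Finset.mem_filter.mpr ⟨(mem_antiExc_iff_of_le w hrx).mpr (Or.inr hx),
            hrx, (Fin.le_def.mp hxb).trans_lt hbt.2⟩,
          fun h => (((mem_antiExc_zero w x).mp (Finset.mem_filter.mp h).1).trans hx).not_ge hrx⟩)
        split_ifs at this <;> omega
      · rw [if_pos hbt, if_pos ⟨not_lt.mp har, (Fin.lt_def.mp hab).trans hbt.2⟩] at this
        omega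
    · rw [if_neg hbt] at this
      omega
  · have hP : ∀ x : Fin n, (x - r).val < t ↔ ¬ (r.val + t - n ≤ x.val ∧ x < r) := by
      intro x
      have := x.isLt
      rw [Fin.val_sub_eq_ite]
      split_ifs with hx <;> simp only [Fin.le_def, Fin.lt_def] at * <;> omega
    simp only [hP]
    set s := r.val + t - n
    have h1 := Finset.card_filter_add_card_filter_not
      (s := antiExc w r) (fun x => s ≤ x.val ∧ x < r)
    have h2 := Finset.card_filter_add_card_filter_not
      (s := insert b ((antiExc w 0).erase a)) (fun x => s ≤ x.val ∧ x < r)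
    have hsub : (antiExc w r).filter (fun x => s ≤ x.val ∧ x < r) ⊆
        (antiExc w 0).filter fun x => s ≤ x.val ∧ x < r := by
      intro x hx
      obtain ⟨hxI, hxP⟩ := Finset.mem_filter.mp hx
      exact Finset.mem_filter.mpr
        ⟨(mem_antiExc_zero w x).mpr ((mem_antiExc_iff_of_lt w hxP.2).mp hxI).1, hxP⟩
    have hle := Finset.card_le_card hsub
    have := hex fun x => s ≤ x.val ∧ x < r
    by_cases hat : s ≤ a.val ∧ a < r
    · by_cases hbr : r ≤ b
      · obtain ⟨x, hax, hxr, hx⟩ := hleft r hat.2 hbr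
        have hlt := Finset.card_lt_card ((Finset.ssubset_iff_of_subset hsub).mpr ⟨x,
          Finset.mem_filter.mpr ⟨(mem_antiExc_zero w x).mpr (hxr.trans_le hx),
            hat.1.trans (Fin.le_def.mp hax), hxr⟩,
          fun h => ((mem_antiExc_iff_of_lt w hxr).mp (Finset.mem_filter.mp h).1).2.not_ge hx⟩)
        split_ifs at this <;> omega
      · rw [if_pos hat, if_pos ⟨hat.1.trans (Fin.lt_def.mp hab).le, not_le.mp hbr⟩] at this
        omega
    · rw [if_neg hat] at this
      omega

theorem Finset.exists_injOn_of_card_le {α : Type*} [DecidableEq α] {S T : Finset α}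
    (h : S.card ≤ T.card) : ∃ g : α → α, Set.InjOn g S ∧ ∀ x ∈ S, g x ∈ T := by
  obtain ⟨U, hU, hcard⟩ := Finset.exists_subset_card_eq h
  let e := Finset.equivOfCardEq hcard.symm
  refine ⟨fun x => if hx : x ∈ S then e ⟨x, hx⟩ else x, fun x hx y hy hxy => ?_, fun x hx => ?_⟩
  · have hx' : x ∈ S := hx
    have hy' : y ∈ S := hy
    simpa [hx', hy', Subtype.ext_iff] using hxy
  · simpa [hx] using hU (e ⟨x, hx⟩).2

/-- For a fixed rightward arc `v b → b`, the leftward arcs failing to exchange with it through a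
gap inject into the rightward arcs that nest it. -/
theorem exists_injOn_nesting_right {n : ℕ} (v : Equiv.Perm (Fin n)) (b : Fin n) :
    ∃ g : Fin n → Fin n,
      Set.InjOn g {a | v b ≤ v a ∧ GapRight v a b} ∧
      ∀ a, (v b ≤ v a ∧ GapRight v a b) →
        v (g a) < v b ∧ b < g a := by
  let G := Finset.univ.filter fun r => r ≤ b ∧ ∀ x, r ≤ x → x ≤ b → r ≤ v x
  by_cases hG : G.Nonempty
  · obtain ⟨r, hrG, hmax⟩ := G.exists_max_image id hG
    obtain ⟨hrb, hr⟩ := (Finset.mem_filter.mp hrG).2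
    obtain ⟨g, hinj, hg⟩ := Finset.exists_injOn_of_card_le (v.card_crossing_eq r).le
    have hmem : ∀ a, (v b ≤ v a ∧ GapRight v a b) →
        a ∈ Finset.univ.filter fun x => x < r ∧ r ≤ v x := by
      rintro a ⟨hba, q, haq, hqb, hq⟩
      have hqr : q ≤ r := hmax q (by simp only [G, Finset.mem_filter, Finset.mem_univ]; tauto)
      simpa using ⟨haq.trans_le hqr, (hr b hrb le_rfl).trans hba⟩
    refine ⟨g, hinj.mono hmem, fun a ha => ?_⟩
    have hga := hg a (hmem a ha)
    simp only [Finset.mem_filter, Finset.mem_univ, true_and] at hga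
    have hvb := hr b hrb le_rfl
    exact ⟨hga.2.trans_le hvb, not_le.mp fun h => hga.2.not_ge (hr _ hga.1 h)⟩
  · have hempty : ∀ a, ¬ (v b ≤ v a ∧ GapRight v a b) := by
      rintro a ⟨-, r, -, hr⟩
      exact hG ⟨r, by simpa [G] using hr⟩
    exact ⟨id, Function.injective_id.injOn, fun a ha => (hempty a ha).elim⟩

/-- For a fixed leftward arc `v a → a`, the rightward arcs failing to exchange with it through a
gap inject into the leftward arcs that nest it. -/
theorem exists_injOn_nesting_left {n : ℕ} (v : Equiv.Perm (Fin n)) (a : Fin n) :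
    ∃ g : Fin n → Fin n,
      Set.InjOn g {b | v b ≤ v a ∧ GapLeft v a b} ∧
      ∀ b, (v b ≤ v a ∧ GapLeft v a b) →
        g b < a ∧ v a < v (g b) := by
  let G := Finset.univ.filter fun r => a < r ∧ ∀ x, a ≤ x → x < r → v x < r
  by_cases hG : G.Nonempty
  · obtain ⟨r, hrG, hmin⟩ := G.exists_min_image id hG
    obtain ⟨har, hr⟩ := (Finset.mem_filter.mp hrG).2
    obtain ⟨g, hinj, hg⟩ := Finset.exists_injOn_of_card_le (v.card_crossing_eq r).ge
    have hva := hr a le_rfl har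
    have hmem : ∀ b, (v b ≤ v a ∧ GapLeft v a b) →
        b ∈ Finset.univ.filter fun x => r ≤ x ∧ v x < r := by
      rintro b ⟨hba, q, haq, hqb, hq⟩
      have hrq : r ≤ q := hmin q (by simp only [G, Finset.mem_filter, Finset.mem_univ]; tauto)
      simpa using ⟨hrq.trans hqb, hba.trans_lt hva⟩
    refine ⟨g, hinj.mono hmem, fun b hb => ?_⟩
    have hgb := hg b (hmem b hb)
    simp only [Finset.mem_filter, Finset.mem_univ, true_and] at hgb
    exact ⟨not_le.mp fun h => hgb.2.not_gt (hr _ h hgb.1), hva.trans_le hgb.2⟩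
  · have hempty : ∀ b, ¬ (v b ≤ v a ∧ GapLeft v a b) := by
      rintro b ⟨-, r, har, -, hr⟩
      exact hG ⟨r, by simpa [G] using ⟨har, hr⟩⟩
    exact ⟨id, Function.injective_id.injOn, fun b hb => (hempty b hb).elim⟩

/-- The map sending an exchange `(a, b)` to the targets of a pair of arcs: those of `b` and `a`
when they are disjoint, and otherwise a pair of nested arcs containing `b` or `a`. -/
theorem exists_injOn_target_pairs {n : ℕ} (v : Equiv.Perm (Fin n)) :
    ∃ F : Fin n × Fin n → Fin n × Fin n,
      Set.InjOn F {p | IsGapPair v p} ∧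
      ∀ p : Fin n × Fin n, IsGapPair v p →
        (F p).1 ≠ (F p).2 ∧
          cyclic4 (v (F p).1).val (F p).1.val (F p).2.val (v (F p).2).val := by
  classical
  choose g hginj hg using exists_injOn_nesting_right v
  choose k hkinj hk using exists_injOn_nesting_left v
  let F : Fin n × Fin n → Fin n × Fin n := fun p =>
    if p.2 < p.1 ∨ v p.1 < v p.2 then (p.2, p.1)
    else if GapRight v p.1 p.2 then (p.2, g p.2 p.1)
    else (k p.1 p.2, p.1)
  have hF : ∀ p : Fin n × Fin n, IsGapPair v p →
      ((p.2 < p.1 ∨ v p.1 < v p.2) ∧ F p = (p.2, p.1)) ∨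
      ((v p.2 ≤ v p.1 ∧ GapRight v p.1 p.2) ∧
        F p = (p.2, g p.2 p.1)) ∨
      ((v p.2 ≤ v p.1 ∧ GapLeft v p.1 p.2) ∧
        F p = (k p.1 p.2, p.1)) := by
    rintro ⟨a, b⟩ ⟨ha, hb, hab⟩
    by_cases h0 : b < a ∨ v a < v b
    · exact Or.inl ⟨h0, if_pos h0⟩
    · push Not at h0
      have hne : a ≠ b := by rintro rfl; exact lt_asymm ha hb
      have hF0 : ¬ (b < a ∨ v a < v b) := by push Not; exact h0
      by_cases h1 : GapRight v a b
      · exact Or.inr (Or.inl ⟨⟨h0.2, h1⟩, by simp only [F, if_neg hF0, if_pos h1]⟩)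
      · exact Or.inr (Or.inr ⟨⟨h0.2, (hab (lt_of_le_of_ne h0.1 hne)).resolve_left h1⟩,
          by simp only [F, if_neg hF0, if_neg h1]⟩)
  refine ⟨F, ?_, ?_⟩
  · rintro ⟨a, b⟩ hp ⟨a', b'⟩ hp' heq
    obtain ⟨ha, hb, -⟩ := id hp
    obtain ⟨ha', hb', -⟩ := id hp'
    dsimp only at ha hb ha' hb'
    rcases hF _ hp with ⟨-, h⟩ | ⟨hc, h⟩ | ⟨hc, h⟩ <;>
    rcases hF _ hp' with ⟨-, h'⟩ | ⟨hc', h'⟩ | ⟨hc', h'⟩ <;>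
    rw [h, h', Prod.mk.injEq] at heq <;> obtain ⟨h1, h2⟩ := heq <;> dsimp only at h1 h2
    · rw [h1, h2]
    · have := hg b' a' hc'
      grind
    · have := hk a' b' hc'
      grind
    · have := hg b a hc
      grind
    · subst h1
      exact Prod.ext (hginj b hc hc' h2) rfl
    · have := hk a' b' hc'
      grind
    · have := hk a b hc
      grind
    · have := hk a b hc
      grind
    · subst h2
      exact Prod.ext rfl (hkinj a hc hc' h1)
  · rintro ⟨a, b⟩ hp
    obtain ⟨ha, hb, -⟩ := id hp
    dsimp only at ha hb
    rcases hF _ hp with ⟨hc, h⟩ | ⟨hc, h⟩ | ⟨hc, h⟩ <;> rw [h] <;> dsimp only at hc ⊢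
    · simp only [Fin.lt_def] at ha hb hc
      refine ⟨by rintro rfl; omega, ?_⟩
      unfold cyclic4
      split_ifs <;> omega
    · have := hg b a hc
      simp only [Fin.lt_def] at ha hb this
      refine ⟨fun h => by rw [← h] at this; omega, ?_⟩
      unfold cyclic4
      split_ifs <;> omega
    · have := hk a b hc
      simp only [Fin.lt_def] at ha hb this
      refine ⟨fun h => by rw [h] at this; omega, ?_⟩
      unfold cyclic4
      split_ifs <;> omega

/-- There is an injection from the anti-exchange pairs of `I_1(w)` into the alignments
of `w`; in particular there are at most as many anti-exchange pairs as alignments. -/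
theorem anti_exchange_pairs_le_alignments (n : ℕ) [NeZero n] (w : Equiv.Perm (Fin n))
    (hw : ∀ i, w i ≠ i) :
    ∃ f : Fin n × Fin n → Fin n × Fin n,
      Set.InjOn f ↑(Finset.univ.filter fun p : Fin n × Fin n =>
        p.1 ∈ antiExc w 0 ∧ p.2 ∉ antiExc w 0 ∧
        ¬ ∀ r : Fin n, shiftedGaleLE r (antiExc w r)
            (insert p.2 ((antiExc w 0).erase p.1))) ∧
      (∀ p ∈ (Finset.univ.filter fun p : Fin n × Fin n =>
          p.1 ∈ antiExc w 0 ∧ p.2 ∉ antiExc w 0 ∧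
          ¬ ∀ r : Fin n, shiftedGaleLE r (antiExc w r)
              (insert p.2 ((antiExc w 0).erase p.1))),
        isAlignment w (f p).1 (f p).2) ∧
      (Finset.univ.filter fun p : Fin n × Fin n =>
          p.1 ∈ antiExc w 0 ∧ p.2 ∉ antiExc w 0 ∧
          ¬ ∀ r : Fin n, shiftedGaleLE r (antiExc w r)
              (insert p.2 ((antiExc w 0).erase p.1))).card ≤
        (Finset.univ.filter fun p : Fin n × Fin n => isAlignment w p.1 p.2).card := by
  classical
  obtain ⟨F, hinj, hF⟩ := exists_injOn_target_pairs w.symm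
  set A := Finset.univ.filter fun p : Fin n × Fin n =>
    p.1 ∈ antiExc w 0 ∧ p.2 ∉ antiExc w 0 ∧
    ¬ ∀ r : Fin n, shiftedGaleLE r (antiExc w r) (insert p.2 ((antiExc w 0).erase p.1)) with hA
  have hmem : ∀ p ∈ A, IsGapPair w.symm p := by
    intro p hp
    obtain ⟨ha, hb, h⟩ := (Finset.mem_filter.mp hp).2
    refine ⟨(mem_antiExc_zero w p.1).mp ha, lt_of_le_of_ne ?_ fun he => ?_,
      fun hab => exists_gap_of_anti_exchange w ha hb hab h⟩
    · exact not_lt.mp fun hlt => hb ((mem_antiExc_zero w p.2).mpr hlt)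
    · exact hw p.2 (w.symm_apply_eq.mp he).symm
  let f : Fin n × Fin n → Fin n × Fin n := fun p => (w.symm (F p).1, w.symm (F p).2)
  have hfinj : Set.InjOn f A := by
    intro p hp q hq hpq
    obtain ⟨h1, h2⟩ := Prod.mk.inj hpq
    exact hinj (hmem p hp) (hmem q hq) (Prod.ext (w.symm.injective h1) (w.symm.injective h2))
  have hfal : ∀ p ∈ A, isAlignment w (f p).1 (f p).2 := by
    intro p hp
    obtain ⟨hne, hcyc⟩ := hF p (hmem p hp)
    refine ⟨w.symm.injective.ne hne, ?_⟩
    simpa only [f, Equiv.apply_symm_apply] using hcyc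
  exact ⟨f, hfinj, hfal, Finset.card_le_card_of_injOn f
    (fun p hp => by simpa using hfal p hp) hfinj⟩
end
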